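/- Assume there exists a continuous ω = (ω_2,…,ω_m) : U → ℝ^{m−1} such that D^φφ = ω in the broad* sense on U. Then φ ∈ UID(U), and at every a_0 ∈ U the intrinsic gradient satisfies ∇^φφ(a_0) = ω(a_0). -/

import Mathlib

open MeasureTheory Filter Topology

namespace Step2

/-- The underlying space of the step-2 Carnot group `G = ℝ^m × ℝ^h`. -/
abbrev G (m h : ℕ) := (Fin m → ℝ) × (Fin h → ℝ)

variable {m h : ℕ}

/-- Group product `(x,y)·(x',y') = (x+x', y+y' - (1/2)⟨Bx,x'⟩)`. -/
noncomputable def gmul (B : Fin h → Matrix (Fin m) (Fin m) ℝ) (p q : G m h) : G m h :=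
  (p.1 + q.1, fun i => p.2 i + q.2 i - (1 / 2) * ∑ j, ∑ k, B i j k * p.1 k * q.1 j)

/-- Group inverse `g⁻¹ = -g`. -/
def ginv (p : G m h) : G m h := (-p.1, -p.2)

/-- Homogeneous norm `‖(x,y)‖ = Σ|x_j| + Σ|y_i|^(1/2)`. -/
noncomputable def hnorm (p : G m h) : ℝ :=
  (∑ j, |p.1 j|) + ∑ i, Real.sqrt |p.2 i|

/-- Homogeneous (quasi-)distance `d(p,q) = ‖p⁻¹·q‖`. -/
noncomputable def gdist (B : Fin h → Matrix (Fin m) (Fin m) ℝ) (p q : G m h) : ℝ :=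
  hnorm (gmul B (ginv p) q)

/-- Euclidean distance on `G`. -/
noncomputable def eDist (p q : G m h) : ℝ :=
  Real.sqrt ((∑ j, (p.1 j - q.1 j) ^ 2) + ∑ i, (p.2 i - q.2 i) ^ 2)

/-- The subgroup `W = {x_1 = 0}`. -/
def Wset (m h : ℕ) [NeZero m] : Set (G m h) := {p | p.1 0 = 0}

/-- `U` is (relatively) open in `W`. -/
def RelOpen (m h : ℕ) [NeZero m] (U : Set (G m h)) : Prop :=
  ∃ O : Set (G m h), IsOpen O ∧ U = O ∩ Wset m h

/-- The graphing map `Φ(w) = (φ(w),0,…,0) ∈ L`. -/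
noncomputable def Phi [NeZero m] (φ : G m h → ℝ) (w : G m h) : G m h :=
  ((fun j => if j = 0 then φ w else 0), 0)

/-- Horizontal coordinate vector `e_{x_j}`. -/
def eH (m h : ℕ) (j : Fin m) : G m h := ((fun j' => if j' = j then 1 else 0), 0)

/-- Vertical coordinate vector `e_{y_i}`. -/
def eV (m h : ℕ) (i : Fin h) : G m h := (0, fun i' => if i' = i then 1 else 0)

/-- The projected vector field `D^φ_j` (for `j ≠ 0`, i.e. `j = 2,…,m` in 1-based indexing):
`D^φ_j|_w = ∂_{x_j} - Σ_i ( b^(i)_{j1} φ(w) + (1/2) Σ_{k≥2} x_k b^(i)_{jk} ) ∂_{y_i}`. -/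
noncomputable def Dvec [NeZero m] (B : Fin h → Matrix (Fin m) (Fin m) ℝ)
    (φ : G m h → ℝ) (j : Fin m) (w : G m h) : G m h :=
  ((fun j' => if j' = j then 1 else 0),
   fun i => -(B i j 0 * φ w
      + (1 / 2) * ∑ k ∈ Finset.univ.erase (0 : Fin m), w.1 k * B i j k))

/-- `D^φφ = ω` in the broad* sense on `U`. -/
def IsBroadStar [NeZero m] (B : Fin h → Matrix (Fin m) (Fin m) ℝ) (U : Set (G m h))
    (φ : G m h → ℝ) (ω : G m h → Fin m → ℝ) : Prop :=
  ∀ a₀ ∈ U, ∃ δ₁ δ₂ : ℝ, 0 < δ₂ ∧ δ₂ < δ₁ ∧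
    ∀ j : Fin m, j ≠ 0 → ∃ E : G m h → ℝ → G m h,
      ∀ a, a ∈ U → eDist a a₀ ≤ δ₂ →
        (∀ t ∈ Set.Icc (-δ₂) δ₂, E a t ∈ U ∧ eDist (E a t) a₀ ≤ δ₁) ∧
        E a 0 = a ∧
        (∀ t ∈ Set.Icc (-δ₂) δ₂,
          HasDerivWithinAt (E a) (Dvec B φ j (E a t)) (Set.Icc (-δ₂) δ₂) t) ∧
        (∀ t ∈ Set.Icc (-δ₂) δ₂, φ (E a t) - φ a = ∫ s in (0:ℝ)..t, ω (E a s) j)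

/-- `φ` is vertically broad* Hölder on `U`. -/
def VertHolder (m h : ℕ) [NeZero m] (U : Set (G m h)) (φ : G m h → ℝ) : Prop :=
  ∀ a₀ ∈ U, ∃ U' : Set (G m h), RelOpen m h U' ∧ a₀ ∈ U' ∧
    IsCompact (closure U') ∧ closure U' ⊆ U ∧
    ∀ i : Fin h, ∀ ε > (0:ℝ), ∃ ρ > (0:ℝ), ∀ p ∈ U', ∀ q ∈ U',
      p.1 = q.1 → (∀ i' : Fin h, i' ≠ i → p.2 i' = q.2 i') →
      0 < |p.2 i - q.2 i| → |p.2 i - q.2 i| ≤ ρ →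
      |φ p - φ q| ≤ ε * Real.sqrt |p.2 i - q.2 i|

/-- The translated point `Φ(a)⁻¹·a⁻¹·b·Φ(a)`. -/
noncomputable def shiftQ [NeZero m] (B : Fin h → Matrix (Fin m) (Fin m) ℝ)
    (φ : G m h → ℝ) (a b : G m h) : G m h :=
  gmul B (gmul B (gmul B (ginv (Phi φ a)) (ginv a)) b) (Phi φ a)

/-- `φ` is intrinsically differentiable at `a₀` with intrinsic gradient `grad`. -/
def IDAt [NeZero m] (B : Fin h → Matrix (Fin m) (Fin m) ℝ) (U : Set (G m h))
    (φ : G m h → ℝ) (a₀ : G m h) (grad : Fin m → ℝ) : Prop :=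
  ∀ ε > (0:ℝ), ∃ r > (0:ℝ), ∀ b ∈ U, 0 < gdist B a₀ b → gdist B a₀ b < r →
    |φ b - φ a₀ - ∑ j ∈ Finset.univ.erase (0 : Fin m), grad j * (b.1 j - a₀.1 j)|
      ≤ ε * hnorm (shiftQ B φ a₀ b)

/-- `φ` is uniformly intrinsically differentiable at `a₀` with intrinsic gradient `grad`. -/
def UIDAt [NeZero m] (B : Fin h → Matrix (Fin m) (Fin m) ℝ) (U : Set (G m h))
    (φ : G m h → ℝ) (a₀ : G m h) (grad : Fin m → ℝ) : Prop :=
  ∀ ε > (0:ℝ), ∃ r > (0:ℝ), ∀ a ∈ U, ∀ b ∈ U,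
    gdist B a₀ a < r → gdist B a₀ b < r → a ≠ b →
    |φ b - φ a - ∑ j ∈ Finset.univ.erase (0 : Fin m), grad j * (b.1 j - a.1 j)|
      ≤ ε * hnorm (shiftQ B φ a b)

/-- Projection onto `L` in the splitting `G = W·L`. -/
def piL (m h : ℕ) [NeZero m] (g : G m h) : G m h :=
  ((fun j => if j = 0 then g.1 0 else 0), 0)

/-- Projection onto `W` in the splitting `G = W·L`. -/
noncomputable def piW [NeZero m] (B : Fin h → Matrix (Fin m) (Fin m) ℝ) (g : G m h) : G m h :=
  ((fun j => if j = 0 then 0 else g.1 j),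
   fun i => g.2 i + (1 / 2) * g.1 0 * ∑ k ∈ Finset.univ.erase (0 : Fin m), B i 0 k * g.1 k)

/-- Coordinates `ℝ^(m-1) × ℝ^h → W ⊆ G`. -/
def emb (m h : ℕ) (u : (Fin (m - 1) → ℝ) × (Fin h → ℝ)) : G m h :=
  ((fun j => if hj : (j : ℕ) = 0 then 0
      else u.1 ⟨(j : ℕ) - 1, by have := j.isLt; omega⟩), u.2)

/-- The Lebesgue measure on `W`, as a measure on `G`. -/
noncomputable def muW (m h : ℕ) : Measure (G m h) :=
  Measure.map (emb m h) volume

end Step2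

namespace Step2

/-- The endpoint of a horizontal step: starting at `p`, the coordinate `x_j` grows by `s` while the
integral of `φ` along the path equals `c`. -/
noncomputable def stepEnd {m h : ℕ} [NeZero m] (B : Fin h → Matrix (Fin m) (Fin m) ℝ) (j : Fin m)
    (p : G m h) (s c : ℝ) : G m h :=
  (p.1 + Pi.single j s, fun i => p.2 i - s / 2 * (B i).mulVec p.1 j - B i j 0 * c)

/-- Near `a₀`, one can move in each direction `j ≠ 0` in such a way that `φ` is almost affine with
slope `w j` along the path; `I s` is the integral of `φ` along the path up to time `s`. -/
def HasSteps {m h : ℕ} [NeZero m] (B : Fin h → Matrix (Fin m) (Fin m) ℝ) (φ : G m h → ℝ)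
    (a₀ : G m h) (w : Fin m → ℝ) (M : ℝ) : Prop :=
  ∀ θ > (0 : ℝ), ∃ ρ > (0 : ℝ), ∀ j ≠ (0 : Fin m), ∀ p : G m h, p.1 0 = 0 → ‖p - a₀‖ < ρ →
    ∃ I : ℝ → ℝ, ContinuousOn I (Set.Icc (-ρ) ρ) ∧ ∀ s ∈ Set.Icc (-ρ) ρ,
      ‖stepEnd B j p s (I s) - p‖ ≤ M * |s| ∧
      |I s - (φ p * s + w j * s ^ 2 / 2)| ≤ θ * s ^ 2 ∧
      |φ (stepEnd B j p s (I s)) - φ p - s * w j| ≤ θ * |s|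

theorem norm_sub_le_of_hasDerivWithinAt_of_lt {E : Type*} [NormedAddCommGroup E] [NormedSpace ℝ E]
    {f f' : ℝ → E} {M T : ℝ} (hM : 0 ≤ M)
    (hf : ∀ x ∈ Set.Icc (-T) T, HasDerivWithinAt f (f' x) (Set.Icc (-T) T) x)
    (hb : ∀ x ∈ Set.Icc (-T) T, ‖f x - f 0‖ ≤ M * T → ‖f' x‖ < M) :
    ∀ x ∈ Set.Icc (-T) T, ‖f x - f 0‖ ≤ M * |x| := by
  have key : ∀ g g' : ℝ → E, g 0 = f 0 →
      (∀ x ∈ Set.Icc (-T) T, HasDerivWithinAt g (g' x) (Set.Icc (-T) T) x) →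
      (∀ x ∈ Set.Icc (-T) T, ‖g x - f 0‖ ≤ M * T → ‖g' x‖ < M) →
      ∀ x ∈ Set.Icc 0 T, ‖g x - f 0‖ ≤ M * x := by
    intro g g' h0 hg hgb
    apply image_norm_le_of_norm_deriv_right_lt_deriv_boundary' (f := fun x => g x - f 0)
      (f' := g') (B := fun x => M * x) (B' := fun _ => M)
    · intro x hx
      have hx' : x ∈ Set.Icc (-T) T := ⟨by linarith [hx.1, hx.2], hx.2⟩
      exact ((hg x hx').continuousWithinAt.mono
        (Set.Icc_subset_Icc (by linarith [hx.1, hx.2]) le_rfl)).sub continuousWithinAt_const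
    · intro x hx
      have hx' : x ∈ Set.Icc (-T) T := ⟨by linarith [hx.1, hx.2], hx.2.le⟩
      refine ((hg x hx').sub_const (f 0)).mono_of_mem_nhdsWithin ?_
      exact mem_of_superset (Icc_mem_nhdsGE hx.2)
        (Set.Icc_subset_Icc (by linarith [hx.1, hx.2]) le_rfl)
    · simp [h0]
    · fun_prop
    · intro x _
      simpa using ((hasDerivAt_id x).const_mul M).hasDerivWithinAt
    · intro x hx hxe
      have hx' : x ∈ Set.Icc (-T) T := ⟨by linarith [hx.1, hx.2], hx.2.le⟩
      exact hgb x hx' (hxe.le.trans (by gcongr; exact hx.2.le))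
  intro x hx
  rcases le_total 0 x with h | h
  · rw [abs_of_nonneg h]
    exact key f f' rfl hf hb x ⟨h, hx.2⟩
  · rw [abs_of_nonpos h]
    have hmem : ∀ y ∈ Set.Icc (-T) T, -y ∈ Set.Icc (-T) T :=
      fun y hy => ⟨by linarith [hy.2], by linarith [hy.1]⟩
    have := key (fun y => f (-y)) (fun y => -f' (-y)) (by simp)
      (fun y hy => by
        have := (hf (-y) (hmem y hy)).scomp y (hasDerivAt_neg y).hasDerivWithinAt hmem
        simpa [Function.comp_def] using this)
      (fun y hy h => by simpa using hb (-y) (hmem y hy) h) (-x)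
      ⟨by linarith, by linarith [hx.1]⟩
    simpa using this

theorem mulVec_add_single_apply {m : ℕ} (A : Matrix (Fin m) (Fin m) ℝ) (v : Fin m → ℝ)
    (j k : Fin m) (s : ℝ) :
    A.mulVec (v + Pi.single j s) k = A.mulVec v k + s * A k j := by
  simp [Matrix.mulVec_add, Matrix.mulVec_single]

theorem apply_eq_neg_of_skew {m : ℕ} {A : Matrix (Fin m) (Fin m) ℝ} (hA : A.transpose = -A)
    (j k : Fin m) : A j k = -A k j := by
  have := congrFun (congrFun hA k) j
  simpa using this

theorem diag_eq_zero_of_skew {m : ℕ} {A : Matrix (Fin m) (Fin m) ℝ} (hA : A.transpose = -A)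
    (j : Fin m) : A j j = 0 := by
  linarith [apply_eq_neg_of_skew hA j j]

theorem hasDerivWithinAt_fst_snd {m h : ℕ} {f : ℝ → G m h} {f' : G m h} {s : Set ℝ} {x : ℝ}
    (hf : HasDerivWithinAt f f' s x) :
    (∀ j, HasDerivWithinAt (fun t => (f t).1 j) (f'.1 j) s x) ∧
      ∀ i, HasDerivWithinAt (fun t => (f t).2 i) (f'.2 i) s x := by
  constructor
  · have h1 : HasDerivWithinAt (fun t => (f t).1) f'.1 s x :=
      (ContinuousLinearMap.fst ℝ (Fin m → ℝ) (Fin h → ℝ)).hasFDerivAt.comp_hasDerivWithinAt x hf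
    exact hasDerivWithinAt_pi.1 h1
  · have h1 : HasDerivWithinAt (fun t => (f t).2) f'.2 s x :=
      (ContinuousLinearMap.snd ℝ (Fin m → ℝ) (Fin h → ℝ)).hasFDerivAt.comp_hasDerivWithinAt x hf
    exact hasDerivWithinAt_pi.1 h1

theorem eq_of_hasDerivWithinAt_zero {f : ℝ → ℝ} {T : ℝ}
    (hf : ∀ x ∈ Set.Icc (-T) T, HasDerivWithinAt f 0 (Set.Icc (-T) T) x) {x : ℝ}
    (hx : x ∈ Set.Icc (-T) T) : f x = f 0 := by
  have h0 : (0 : ℝ) ∈ Set.Icc (-T) T := ⟨by linarith [hx.1, hx.2], by linarith [hx.1, hx.2]⟩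
  have := (convex_Icc (-T) T).norm_image_sub_le_of_norm_hasDerivWithin_le (C := 0) hf
    (by simp) h0 hx
  rw [zero_mul, norm_le_zero_iff, sub_eq_zero] at this
  exact this

/-- An integral curve of `D^φ_j` is a horizontal step. -/
theorem eq_stepEnd_of_hasDerivWithinAt {m h : ℕ} [NeZero m]
    {B : Fin h → Matrix (Fin m) (Fin m) ℝ} (hskew : ∀ i, (B i).transpose = - B i)
    {φ : G m h → ℝ} {j : Fin m} (hj : j ≠ 0) {γ : ℝ → G m h} {T : ℝ} (h00 : (γ 0).1 0 = 0)
    (hγ : ∀ t ∈ Set.Icc (-T) T, HasDerivWithinAt γ (Dvec B φ j (γ t)) (Set.Icc (-T) T) t)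
    {I : ℝ → ℝ} (hI0 : I 0 = 0)
    (hI : ∀ t ∈ Set.Icc (-T) T, HasDerivWithinAt I (φ (γ t)) (Set.Icc (-T) T) t) :
    ∀ t ∈ Set.Icc (-T) T, γ t = stepEnd B j (γ 0) t (I t) := by
  have hx : ∀ t ∈ Set.Icc (-T) T, (γ t).1 = (γ 0).1 + Pi.single j t := by
    intro t ht
    funext k
    have := eq_of_hasDerivWithinAt_zero (f := fun t => (γ t).1 k - (Pi.single j t : Fin m → ℝ) k)
      (T := T) (fun x hx => by
        have h1 := (hasDerivWithinAt_fst_snd (hγ x hx)).1 k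
        by_cases hk : k = j
        · subst hk
          have h2 := h1.sub (hasDerivWithinAt_id x _)
          simp only [Dvec, if_true, sub_self] at h2
          exact h2.congr (fun y _ => by simp) (by simp)
        · simpa [Dvec, hk] using h1) ht
    simp only [Pi.single_zero, Pi.zero_apply, sub_zero] at this
    simp only [Pi.add_apply]
    linarith
  intro t ht
  refine Prod.ext (hx t ht) ?_
  funext i
  have := eq_of_hasDerivWithinAt_zero
    (f := fun t => (γ t).2 i + t * (1 / 2 * (B i).mulVec (γ 0).1 j) + B i j 0 * I t)
    (T := T) (fun x hxT => by
      have h1 := (hasDerivWithinAt_fst_snd (hγ x hxT)).2 i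
      have h2 := (h1.add ((hasDerivWithinAt_id x _).mul_const
        (1 / 2 * (B i).mulVec (γ 0).1 j))).add ((hI x hxT).const_mul (B i j 0))
      refine h2.congr_deriv ?_
      have h3 : ∑ k ∈ Finset.univ.erase (0 : Fin m), (γ x).1 k * B i j k
          = (B i).mulVec (γ 0).1 j := by
        have h4 : (B i).mulVec (γ x).1 j = (B i).mulVec (γ 0).1 j := by
          rw [hx x hxT, mulVec_add_single_apply, diag_eq_zero_of_skew (hskew i), mul_zero, add_zero]
        rw [← h4, Matrix.mulVec, dotProduct, ← Finset.add_sum_erase _ _ (Finset.mem_univ 0),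
          hx x hxT]
        simp [h00, hj.symm, mul_comm]
      simp only [Dvec, h3]
      ring) ht
  simp only [zero_mul, add_zero, hI0, mul_zero] at this
  simp only [stepEnd]
  linarith

theorem hasSteps_of_isBroadStar {m h : ℕ} [NeZero m]
    {B : Fin h → Matrix (Fin m) (Fin m) ℝ} (hskew : ∀ i, (B i).transpose = - B i)
    {U : Set (G m h)} (hUopen : RelOpen m h U)
    {φ : G m h → ℝ} (hφ : ContinuousOn φ U) {ω : G m h → Fin m → ℝ}
    (hω : ∀ j : Fin m, j ≠ 0 → ContinuousOn (fun w => ω w j) U)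
    (hbroad : IsBroadStar B U φ ω) {a₀ : G m h} (ha₀ : a₀ ∈ U) :
    ∃ M > 0, HasSteps B φ a₀ (ω a₀) M := by
  obtain ⟨δ₁, δ₂, hδ₂, -, hE⟩ := hbroad a₀ ha₀
  set M : ℝ := 1 + ∑ j, ‖Dvec B φ j a₀‖ with hMdef
  have hM : 0 < M := by positivity
  refine ⟨M, hM, fun θ hθ => ?_⟩
  have hDcont : ∀ j, ContinuousOn (Dvec B φ j) U := by
    intro j
    unfold Dvec
    fun_prop
  have hev : ∀ᶠ p in 𝓝[U] a₀, p ∈ U ∧ eDist p a₀ ≤ δ₂ ∧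
      ∀ j ≠ (0 : Fin m), ‖Dvec B φ j p‖ < M ∧ |ω p j - ω a₀ j| ≤ θ := by
    refine eventually_mem_nhdsWithin.and (Eventually.and ?_ (eventually_all.2 fun j => ?_))
    · have hc : Continuous (fun p : G m h => eDist p a₀) := by unfold eDist; fun_prop
      have : Tendsto (fun p : G m h => eDist p a₀) (𝓝[U] a₀) (𝓝 0) := by
        have := hc.tendsto a₀
        rw [show eDist a₀ a₀ = 0 by simp [eDist]] at this
        exact this.mono_left nhdsWithin_le_nhds
      exact (this.eventually (gt_mem_nhds hδ₂)).mono fun _ => le_of_lt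
    · by_cases hj : j = 0
      · exact Eventually.of_forall fun _ h => absurd hj h
      have h1 : ∀ᶠ p in 𝓝[U] a₀, ‖Dvec B φ j p‖ < M := by
        refine ((hDcont j) a₀ ha₀).norm.eventually (gt_mem_nhds ?_)
        have := Finset.single_le_sum (f := fun j => ‖Dvec B φ j a₀‖) (fun _ _ => norm_nonneg _)
          (Finset.mem_univ j)
        linarith
      have h2 : ∀ᶠ p in 𝓝[U] a₀, |ω p j - ω a₀ j| ≤ θ := by
        have := (hω j hj) a₀ ha₀
        filter_upwards [this.eventually (Metric.ball_mem_nhds _ hθ)] with p hp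
        simpa [Real.dist_eq] using le_of_lt hp
      filter_upwards [h1, h2] with p h1 h2 _ using ⟨h1, h2⟩
  obtain ⟨O, hO, rfl⟩ := hUopen
  rw [Set.inter_comm, nhdsWithin_inter_of_mem' (mem_nhdsWithin_of_mem_nhds (hO.mem_nhds ha₀.1)),
    eventually_nhdsWithin_iff, Metric.eventually_nhds_iff] at hev
  obtain ⟨R, hR, hball⟩ := hev
  set ρ : ℝ := min δ₂ (R / (1 + M)) with hρdef
  have hρ : 0 < ρ := by positivity
  have hρδ : ρ ≤ δ₂ := min_le_left _ _
  have hρR : ρ + M * ρ ≤ R := by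
    have : ρ ≤ R / (1 + M) := min_le_right _ _
    rw [le_div_iff₀ (by positivity)] at this
    linarith
  refine ⟨ρ, hρ, fun j hj p hp0 hpρ => ?_⟩
  have hsub : Set.Icc (-ρ) ρ ⊆ Set.Icc (-δ₂) δ₂ := Set.Icc_subset_Icc (by linarith) hρδ
  have hnear : ∀ q : G m h, q.1 0 = 0 → ‖q - p‖ ≤ M * ρ → q ∈ O ∩ Wset m h ∧ eDist q a₀ ≤ δ₂ ∧
      ∀ j ≠ (0 : Fin m), ‖Dvec B φ j q‖ < M ∧ |ω q j - ω a₀ j| ≤ θ := by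
    intro q hq0 hqp
    have hqR : dist q a₀ < R := by
      rw [dist_eq_norm, ← sub_add_sub_cancel q p a₀]
      linarith [norm_add_le (q - p) (p - a₀)]
    have := hball hqR hq0
    rwa [Set.inter_comm] at this
  obtain ⟨hpU, hpe, -⟩ := hnear p hp0 (by simp; positivity)
  obtain ⟨E, hE⟩ := hE j hj
  obtain ⟨hE1, hE0, hE2, hE3⟩ := hE p hpU hpe
  set γ := E p with hγ
  have hd : ∀ t ∈ Set.Icc (-ρ) ρ,
      HasDerivWithinAt γ (Dvec B φ j (γ t)) (Set.Icc (-ρ) ρ) t :=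
    fun t ht => (hE2 t (hsub ht)).mono hsub
  have hγU : ∀ t ∈ Set.Icc (-ρ) ρ, γ t ∈ O ∩ Wset m h := fun t ht => (hE1 t (hsub ht)).1
  have hclose : ∀ t ∈ Set.Icc (-ρ) ρ, ‖γ t - p‖ ≤ M * |t| := by
    have := norm_sub_le_of_hasDerivWithinAt_of_lt hM.le hd (fun t ht h => by
      rw [hE0] at h
      exact ((hnear _ (hγU t ht).2 h).2.2 j hj).1)
    rwa [hE0] at this
  have hγω : ∀ t ∈ Set.Icc (-ρ) ρ, |ω (γ t) j - ω a₀ j| ≤ θ := fun t ht =>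
    ((hnear _ (hγU t ht).2 ((hclose t ht).trans
      (by gcongr; exact abs_le.2 ht))).2.2 j hj).2
  have hγc : ContinuousOn γ (Set.Icc (-ρ) ρ) := fun t ht => (hd t ht).continuousWithinAt
  have hle : -ρ ≤ ρ := by linarith
  have h0mem : (0 : ℝ) ∈ Set.Icc (-ρ) ρ := ⟨by linarith, hρ.le⟩
  have huIcc : ∀ t ∈ Set.Icc (-ρ) ρ, Set.uIcc 0 t ⊆ Set.Icc (-ρ) ρ := fun t ht =>
    Set.uIcc_subset_Icc h0mem ht
  have hφγ : ∀ t ∈ Set.Icc (-ρ) ρ, |φ (γ t) - φ p - t * ω a₀ j| ≤ θ * |t| := by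
    intro t ht
    have hint : IntervalIntegrable (fun s => ω (γ s) j) volume 0 t :=
      (((hω j hj).comp hγc hγU).mono (huIcc t ht)).intervalIntegrable
    have h1 : φ (γ t) - φ p - t * ω a₀ j = ∫ s in (0 : ℝ)..t, (ω (γ s) j - ω a₀ j) := by
      rw [hE3 t (hsub ht), intervalIntegral.integral_sub hint intervalIntegrable_const]
      simp
    rw [h1]
    have := intervalIntegral.norm_integral_le_of_norm_le_const (a := 0) (b := t) (C := θ)
      (f := fun s => ω (γ s) j - ω a₀ j)
      (fun x hx => hγω x (huIcc t ht (Set.uIoc_subset_uIcc hx)))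
    simpa using this
  set f : ℝ → ℝ := Set.IccExtend hle ((Set.Icc (-ρ) ρ).domRestrict (fun t => φ (γ t))) with hf
  have hfc : Continuous f :=
    (continuousOn_iff_continuous_domRestrict.1 (hφ.comp hγc hγU)).Icc_extend'
  have hfe : ∀ t ∈ Set.Icc (-ρ) ρ, f t = φ (γ t) := fun t ht => by
    rw [hf, Set.IccExtend_of_mem _ _ ht, Set.domRestrict_apply]
  set I : ℝ → ℝ := fun s => ∫ x in (0 : ℝ)..s, f x with hIdef
  have hI' : ∀ t, HasDerivAt I (f t) t := fun t => (hfc.integral_hasStrictDerivAt 0 t).hasDerivAt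
  have hI0 : I 0 = 0 := by simp [hIdef]
  have hstep := eq_stepEnd_of_hasDerivWithinAt hskew hj (by rw [hE0]; exact hp0) hd hI0
    (fun t ht => by rw [← hfe t ht]; exact (hI' t).hasDerivWithinAt)
  rw [hE0] at hstep
  refine ⟨I, fun t _ => (hI' t).continuousAt.continuousWithinAt, fun s hs => ?_⟩
  rw [← hstep s hs]
  refine ⟨hclose s hs, ?_, hφγ s hs⟩
  have hconv := (convex_uIcc (0 : ℝ) s).norm_image_sub_le_of_norm_hasDerivWithin_le
    (f := fun t => I t - (φ p * t + ω a₀ j * t ^ 2 / 2)) (C := θ * |s|)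
    (f' := fun t => f t - (φ p + ω a₀ j * t))
    (fun t _ => by
      have h1 : HasDerivAt (fun t : ℝ => φ p * t + ω a₀ j * t ^ 2 / 2) (φ p + ω a₀ j * t) t := by
        have := ((hasDerivAt_id t).const_mul (φ p)).add
          (((hasDerivAt_pow 2 t).const_mul (ω a₀ j)).div_const 2)
        refine this.congr_deriv ?_
        simp
        ring
      exact ((hI' t).sub h1).hasDerivWithinAt)
    (fun t ht => by
      have htρ := huIcc s hs ht
      rw [hfe t htρ, Real.norm_eq_abs]
      have h1 := hφγ t htρ
      have h2 : |t| ≤ |s| := by simpa using Set.abs_sub_left_of_mem_uIcc ht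
      calc |φ (γ t) - (φ p + ω a₀ j * t)| = |φ (γ t) - φ p - t * ω a₀ j| := by ring_nf
        _ ≤ θ * |t| := h1
        _ ≤ θ * |s| := by gcongr)
    Set.left_mem_uIcc Set.right_mem_uIcc
  simp only [hI0, Real.norm_eq_abs, sub_zero, mul_zero, ne_eq, OfNat.ofNat_ne_zero,
    not_false_eq_true, zero_pow, zero_div, add_zero] at hconv
  rwa [mul_assoc, abs_mul_abs_self, ← pow_two] at hconv

/-- `φ` is little `1/2`-Hölder near `a₀` along the vertical direction `v`. -/
def VertLittleHolder {m h : ℕ} [NeZero m] (φ : G m h → ℝ) (a₀ : G m h) (v : Fin h → ℝ) : Prop :=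
  ∀ ε > (0 : ℝ), ∃ ρ > (0 : ℝ), ∀ p : G m h, p.1 0 = 0 → ‖p - a₀‖ < ρ → ∀ t : ℝ, |t| < ρ →
    |φ (p + (0, t • v)) - φ p| ≤ ε * √|t|

theorem norm_vert {m h : ℕ} (v : Fin h → ℝ) : ‖((0, v) : G m h)‖ = ‖v‖ := by
  simp [Prod.norm_def]

theorem norm_add_vert_sub_le {m h : ℕ} (p a₀ : G m h) (t : ℝ) (v : Fin h → ℝ) :
    ‖p + (0, t • v) - a₀‖ ≤ ‖p - a₀‖ + |t| * ‖v‖ := by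
  rw [add_sub_right_comm]
  refine (norm_add_le _ _).trans_eq ?_
  rw [norm_vert, norm_smul, Real.norm_eq_abs]

theorem VertLittleHolder.zero {m h : ℕ} [NeZero m] (φ : G m h → ℝ) (a₀ : G m h) :
    VertLittleHolder φ a₀ 0 := by
  intro ε hε
  refine ⟨1, one_pos, fun p _ _ t _ => ?_⟩
  rw [smul_zero, show ((0, 0) : G m h) = 0 from rfl, add_zero, sub_self, abs_zero]
  positivity

theorem VertLittleHolder.add {m h : ℕ} [NeZero m] {φ : G m h → ℝ} {a₀ : G m h} {u v : Fin h → ℝ}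
    (hu : VertLittleHolder φ a₀ u) (hv : VertLittleHolder φ a₀ v) :
    VertLittleHolder φ a₀ (u + v) := by
  intro ε hε
  obtain ⟨ρ₁, hρ₁, h1⟩ := hu (ε / 2) (by positivity)
  obtain ⟨ρ₂, hρ₂, h2⟩ := hv (ε / 2) (by positivity)
  refine ⟨min ρ₁ (ρ₂ / (1 + ‖u‖)), by positivity, fun p hp0 hp t ht => ?_⟩
  have hp2 := lt_of_lt_of_le hp (min_le_right _ _)
  have ht2 := lt_of_lt_of_le ht (min_le_right _ _)
  have hle : ρ₂ / (1 + ‖u‖) ≤ ρ₂ := div_le_self hρ₂.le (by linarith [norm_nonneg u])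
  have e1 := h1 p hp0 (hp.trans_le (min_le_left _ _)) t (ht.trans_le (min_le_left _ _))
  have e2 := h2 (p + (0, t • u)) (by simpa using hp0) (by
    refine (norm_add_vert_sub_le _ _ _ _).trans_lt ?_
    calc ‖p - a₀‖ + |t| * ‖u‖ < ρ₂ / (1 + ‖u‖) + ρ₂ / (1 + ‖u‖) * ‖u‖ :=
          add_lt_add_of_lt_of_le hp2 (by gcongr)
      _ = ρ₂ := by field_simp) t (ht2.trans_le hle)
  have e3 : p + (0, t • (u + v)) = p + (0, t • u) + (0, t • v) :=
    Prod.ext (by simp) (by simp [add_assoc])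
  rw [e3]
  calc _ ≤ |φ (p + (0, t • u) + (0, t • v)) - φ (p + (0, t • u))| + |φ (p + (0, t • u)) - φ p| :=
        abs_sub_le _ _ _
    _ ≤ _ := by linarith

theorem VertLittleHolder.smul {m h : ℕ} [NeZero m] {φ : G m h → ℝ} {a₀ : G m h} {v : Fin h → ℝ}
    (hv : VertLittleHolder φ a₀ v) (c : ℝ) : VertLittleHolder φ a₀ (c • v) := by
  intro ε hε
  obtain ⟨ρ, hρ, h1⟩ := hv (ε / (1 + √|c|)) (by positivity)
  refine ⟨ρ / (1 + |c|), by positivity, fun p hp0 hp t ht => ?_⟩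
  have hle : ρ / (1 + |c|) ≤ ρ := div_le_self hρ.le (by linarith [abs_nonneg c])
  have e1 := h1 p hp0 (hp.trans_le hle) (t * c) (by
    rw [lt_div_iff₀ (by positivity)] at ht
    rw [abs_mul]
    linarith [abs_nonneg t])
  rw [smul_smul]
  refine e1.trans ?_
  rw [abs_mul, Real.sqrt_mul (abs_nonneg _), div_mul_eq_mul_div, div_le_iff₀ (by positivity)]
  have : 0 ≤ √|t| := Real.sqrt_nonneg _
  nlinarith [mul_nonneg hε.le this]

/-- The vertical directions along which `φ` is little `1/2`-Hölder near `a₀`. -/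
def vertLittleHolderSubmodule {m h : ℕ} [NeZero m] (φ : G m h → ℝ) (a₀ : G m h) :
    Submodule ℝ (Fin h → ℝ) where
  carrier := {v | VertLittleHolder φ a₀ v}
  add_mem' := VertLittleHolder.add
  zero_mem' := VertLittleHolder.zero φ a₀
  smul_mem' c _ hv := VertLittleHolder.smul hv c

/-- Along the vertical direction `(b_{j1})` the integral curves of `D^φ_j` starting at two different
points would meet if `φ` varied too much. -/
theorem HasSteps.vertLittleHolder_col_zero {m h : ℕ} [NeZero m]
    {B : Fin h → Matrix (Fin m) (Fin m) ℝ} {φ : G m h → ℝ} {a₀ : G m h} {w : Fin m → ℝ} {M : ℝ}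
    (H : HasSteps B φ a₀ w M) {j : Fin m} (hj : j ≠ 0) :
    VertLittleHolder φ a₀ (fun i => B i j 0) := by
  intro ε hε
  set c : Fin h → ℝ := fun i => B i j 0 with hc
  obtain ⟨ρ, hρ, hH⟩ := H (ε ^ 2 / 8) (by positivity)
  refine ⟨min (ρ / (1 + ‖c‖)) (ε ^ 2 * ρ ^ 2 / 4), by positivity, fun p hp0 hp t ht => ?_⟩
  have hp1 := lt_of_lt_of_le hp (min_le_left _ _)
  have ht1 := lt_of_lt_of_le ht (min_le_left _ _)
  have ht2 := lt_of_lt_of_le ht (min_le_right _ _)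
  have hle : ρ / (1 + ‖c‖) ≤ ρ := div_le_self hρ.le (by linarith [norm_nonneg c])
  set q : G m h := p + (0, t • c) with hq
  obtain ⟨I, hIc, hI⟩ := hH j hj p hp0 (hp1.trans_le hle)
  obtain ⟨J, hJc, hJ⟩ := hH j hj q (by simpa [hq] using hp0) (by
    refine (norm_add_vert_sub_le _ _ _ _).trans_lt ?_
    calc ‖p - a₀‖ + |t| * ‖c‖ < ρ / (1 + ‖c‖) + ρ / (1 + ‖c‖) * ‖c‖ :=
          add_lt_add_of_lt_of_le hp1 (by gcongr)
      _ = ρ := by field_simp)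
  by_contra! hlt
  set T : ℝ := √|t| with hT
  have hT0 : 0 ≤ T := Real.sqrt_nonneg _
  have hTT : T ^ 2 = |t| := Real.sq_sqrt (abs_nonneg t)
  set S : ℝ := 2 * T / ε with hS
  have hS0 : 0 ≤ S := by positivity
  have hSε : S * ε = 2 * T := by rw [hS]; field_simp
  have hSρ : S ≤ ρ := by
    have h1 : T ≤ ε * ρ / 2 := by
      refine abs_le_of_sq_le_sq' ?_ (by positivity) |>.2
      rw [hTT]
      linarith [ht2, show (ε * ρ / 2) ^ 2 = ε ^ 2 * ρ ^ 2 / 4 by ring]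
    rw [hS, div_le_iff₀ hε]
    linarith
  have hSS : ε ^ 2 / 8 * S ^ 2 = |t| / 2 := by
    have : (S * ε) ^ 2 = 4 * |t| := by rw [hSε, mul_pow, hTT]; ring
    linarith [show ε ^ 2 / 8 * S ^ 2 = (S * ε) ^ 2 / 8 by ring]
  set d : ℝ := φ q - φ p with hd
  have hdS : 2 * |t| ≤ |d| * S := by
    calc 2 * |t| = (ε * T) * S := by rw [← hTT]; linear_combination -T * hSε
      _ ≤ |d| * S := by gcongr
  have hD : ∀ s ∈ Set.Icc (-S) S, |(J s - I s) - d * s| ≤ |t| := by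
    intro s hs
    have hsρ : s ∈ Set.Icc (-ρ) ρ := ⟨by linarith [hs.1], by linarith [hs.2]⟩
    have h1 := (hI s hsρ).2.1
    have h2 := (hJ s hsρ).2.1
    have h3 : ε ^ 2 / 8 * s ^ 2 ≤ |t| / 2 := by
      rw [← hSS]
      gcongr ε ^ 2 / 8 * ?_
      exact sq_le_sq' hs.1 hs.2
    calc |(J s - I s) - d * s|
        = |(J s - (φ q * s + w j * s ^ 2 / 2)) - (I s - (φ p * s + w j * s ^ 2 / 2))| := by
          rw [hd]; ring_nf
      _ ≤ _ := abs_sub _ _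
      _ ≤ |t| := by linarith
  have hmem1 : S ∈ Set.Icc (-S) S := ⟨by linarith, le_rfl⟩
  have hmem2 : -S ∈ Set.Icc (-S) S := ⟨le_rfl, by linarith⟩
  have hcont : ContinuousOn (fun s => J s - I s) (Set.uIcc (-S) S) := by
    rw [Set.uIcc_of_le (by linarith)]
    exact (hJc.sub hIc).mono (Set.Icc_subset_Icc (by linarith) hSρ)
  have htmem : t ∈ Set.uIcc (J (-S) - I (-S)) (J S - I S) := by
    have h1 := abs_le.1 (hD S hmem1)
    have h2 := abs_le.1 (hD (-S) hmem2)
    have h3 := neg_abs_le t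
    have h4 := le_abs_self t
    rw [Set.mem_uIcc]
    rcases le_total 0 d with hd0 | hd0
    · left
      rw [abs_of_nonneg hd0] at hdS
      constructor <;> linarith
    · right
      rw [abs_of_nonpos hd0] at hdS
      constructor <;> linarith
  obtain ⟨s, hs, hst⟩ := intermediate_value_uIcc hcont htmem
  rw [Set.uIcc_of_le (by linarith)] at hs
  simp only at hst
  have hsρ : s ∈ Set.Icc (-ρ) ρ := ⟨by linarith [hs.1], by linarith [hs.2]⟩
  have hmeet : stepEnd B j q s (J s) = stepEnd B j p s (I s) := by
    rw [show J s = I s + t by linarith]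
    refine Prod.ext (by simp [stepEnd, hq]) ?_
    funext i
    simp [stepEnd, hq, hc]
    ring
  have h1 := (hI s hsρ).2.2
  have h2 := (hJ s hsρ).2.2
  rw [hmeet] at h2
  have h3 : |s| ≤ S := abs_le.2 hs
  have h4 : |d| ≤ 2 * (ε ^ 2 / 8 * |s|) := by
    calc |d| = |(φ (stepEnd B j p s (I s)) - φ p - s * w j) -
          (φ (stepEnd B j p s (I s)) - φ q - s * w j)| := by rw [hd]; ring_nf
      _ ≤ _ := abs_sub _ _
      _ ≤ _ := by linarith
  have h5 : 2 * (ε ^ 2 / 8 * |s|) ≤ ε * T := by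
    calc 2 * (ε ^ 2 / 8 * |s|) ≤ 2 * (ε ^ 2 / 8 * S) := by gcongr
      _ = ε * T / 2 := by linear_combination ε / 4 * hSε
      _ ≤ ε * T := by linarith [mul_nonneg hε.le hT0]
  linarith

theorem abs_add_le_of_opposite_steps {I J x y w θ s r D K : ℝ} (hθ : θ ≤ 1) (hs : |s| = r)
    (hw : |w| ≤ K) (hI : |I - (x * s + w * s ^ 2 / 2)| ≤ θ * s ^ 2)
    (hJ : |J - (y * (-s) + w * (-s) ^ 2 / 2)| ≤ θ * (-s) ^ 2) (hxy : |y - x| ≤ D * r) :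
    |I + J| ≤ (D + K + 2) * r ^ 2 := by
  have hs2 : s ^ 2 = r ^ 2 := by rw [← hs, sq_abs]
  have hr : 0 ≤ r := hs ▸ abs_nonneg s
  rw [neg_sq] at hJ
  rw [hs2] at hI hJ
  have h1 : |(y - x) * s| ≤ D * r ^ 2 := by
    rw [abs_mul, hs]
    nlinarith
  have h2 : |w * r ^ 2| ≤ K * r ^ 2 := by
    rw [abs_mul, abs_of_nonneg (sq_nonneg r)]
    gcongr
  have h3 : θ * r ^ 2 ≤ r ^ 2 := mul_le_of_le_one_left (sq_nonneg r) hθ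
  rw [abs_le] at hI hJ h1 h2 ⊢
  constructor <;> linarith

/-- Along the vertical direction `(b_{jk})`, which is that of the commutator of `D^φ_j` and
`D^φ_k`. -/
theorem HasSteps.vertLittleHolder_of_commutator {m h : ℕ} [NeZero m]
    {B : Fin h → Matrix (Fin m) (Fin m) ℝ} (hskew : ∀ i, (B i).transpose = - B i)
    {φ : G m h → ℝ} {a₀ : G m h} {w : Fin m → ℝ} {M : ℝ} (hM : 0 < M)
    (H : HasSteps B φ a₀ w M) {j k : Fin m} (hj : j ≠ 0) (hk : k ≠ 0) :
    VertLittleHolder φ a₀ (fun i => B i j k) := by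
  intro ε hε
  set u : Fin h → ℝ := fun i => B i j 0 with hu
  set v : Fin h → ℝ := fun i => B i k 0 with hv
  set K : ℝ := ‖w‖ with hK
  have hwK : ∀ l, |w l| ≤ K := fun l => norm_le_pi_norm w l
  have hK0 : 0 ≤ K := norm_nonneg w
  set C : ℝ := 3 * K + 4 with hC
  have hC0 : 0 < C := by positivity
  obtain ⟨ρ₁, hρ₁, h1⟩ := H.vertLittleHolder_col_zero hj (ε / (4 * √C)) (by positivity)
  obtain ⟨ρ₂, hρ₂, h2⟩ := H.vertLittleHolder_col_zero hk (ε / (4 * √C)) (by positivity)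
  set θ : ℝ := min 1 (ε / 8) with hθ
  obtain ⟨ρ₃, hρ₃, hH⟩ := H θ (by positivity)
  have hθ1 : θ ≤ 1 := min_le_left _ _
  have hθε : θ ≤ ε / 8 := min_le_right _ _
  set ρ : ℝ := min ρ₁ (min ρ₂ ρ₃) with hρdef
  have hρ : 0 < ρ := by positivity
  have hρ1 : ρ ≤ ρ₁ := min_le_left _ _
  have hρ2 : ρ ≤ ρ₂ := (min_le_right _ _).trans (min_le_left _ _)
  have hρ3 : ρ ≤ ρ₃ := (min_le_right _ _).trans (min_le_right _ _)
  set L : ℝ := 1 + 4 * M + C + C * ‖u‖ with hL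
  have hL0 : 0 < L := by positivity
  set κ : ℝ := min 1 (ρ / L) with hκ
  have hκ0 : 0 < κ := by positivity
  have hκ1 : κ ≤ 1 := min_le_left _ _
  have hκκ : κ ^ 2 ≤ κ := pow_le_of_le_one hκ0.le hκ1 two_ne_zero
  have hκL : κ + 4 * (M * κ) + C * κ + C * κ * ‖u‖ ≤ ρ := by
    have : κ ≤ ρ / L := min_le_right _ _
    rw [le_div_iff₀ hL0] at this
    rw [hL] at this
    linarith
  have hCu : 0 ≤ C * κ * ‖u‖ := by positivity
  have hCκ : 0 < C * κ := by positivity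
  have hMκ : 0 < M * κ := by positivity
  refine ⟨κ ^ 2, by positivity, fun p hp0 hp t ht => ?_⟩
  set r : ℝ := √|t| with hr
  have hr0 : 0 ≤ r := Real.sqrt_nonneg _
  have hrr : r ^ 2 = |t| := Real.sq_sqrt (abs_nonneg t)
  have hrκ : r < κ := by
    refine lt_of_pow_lt_pow_left₀ 2 hκ0.le ?_
    rwa [hrr]
  have hpκ : ‖p - a₀‖ < κ := hp.trans_le hκκ
  obtain ⟨s', hs', hts'⟩ : ∃ s', |s'| = r ∧ r * s' = t := by
    rcases abs_cases t with ⟨h, _⟩ | ⟨h, _⟩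
    · exact ⟨r, abs_of_nonneg hr0, by rw [← pow_two, hrr, h]⟩
    · exact ⟨-r, by rw [abs_neg, abs_of_nonneg hr0], by
        rw [mul_neg, ← pow_two, hrr, h, neg_neg]⟩
  have hrabs : |r| = r := abs_of_nonneg hr0
  have hstep : ∀ l ≠ (0 : Fin m), ∀ q : G m h, q.1 0 = 0 → ‖q - a₀‖ < ρ → ∀ s, |s| = r →
      ∃ I, (stepEnd B l q s I).1 0 = 0 ∧ ‖stepEnd B l q s I - a₀‖ ≤ ‖q - a₀‖ + M * κ ∧
        |I - (φ q * s + w l * s ^ 2 / 2)| ≤ θ * s ^ 2 ∧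
        |φ (stepEnd B l q s I) - φ q - s * w l| ≤ θ * r := by
    intro l hl q hq0 hq s hs
    obtain ⟨I, -, hI⟩ := hH l hl q hq0 (hq.trans_le hρ3)
    have hsm : s ∈ Set.Icc (-ρ₃) ρ₃ := by
      rw [Set.mem_Icc, ← abs_le, hs]
      linarith
    obtain ⟨e1, e2, e3⟩ := hI s hsm
    refine ⟨I s, by simp [stepEnd, hq0, hl.symm], ?_, e2, by rwa [hs] at e3⟩
    rw [← sub_add_sub_cancel _ q a₀]
    refine (norm_add_le _ _).trans ?_
    have : M * |s| ≤ M * κ := by rw [hs]; gcongr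
    linarith
  obtain ⟨I₁, z₁, n₁, i₁, f₁⟩ := hstep j hj p hp0 (by linarith) r hrabs
  set p₁ := stepEnd B j p r I₁ with hp₁
  obtain ⟨I₂, z₂, n₂, i₂, f₂⟩ := hstep k hk p₁ z₁ (by linarith) s' hs'
  set p₂ := stepEnd B k p₁ s' I₂ with hp₂
  obtain ⟨I₃, z₃, n₃, i₃, f₃⟩ := hstep j hj p₂ z₂ (by linarith) (-r) (by rwa [abs_neg])
  set p₃ := stepEnd B j p₂ (-r) I₃ with hp₃
  obtain ⟨I₄, z₄, n₄, i₄, f₄⟩ := hstep k hk p₃ z₃ (by linarith) (-s') (by rwa [abs_neg])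
  set p₄ := stepEnd B k p₃ (-s') I₄ with hp₄
  have hrw : |r * w j| ≤ K * r := by
    rw [abs_mul, hrabs, mul_comm]
    gcongr
    exact hwK j
  have hsw : |s' * w k| ≤ K * r := by
    rw [abs_mul, hs', mul_comm]
    gcongr
    exact hwK k
  have hθr : θ * r ≤ r := mul_le_of_le_one_left hr0 hθ1
  have hA : |I₁ + I₃| ≤ C * r ^ 2 := by
    have := abs_add_le_of_opposite_steps (D := 2 * K + 2) hθ1 hrabs (hwK j) i₁ i₃ (by
      rw [abs_le] at f₁ f₂ hrw hsw ⊢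
      constructor <;> linarith)
    refine this.trans_eq ?_
    rw [hC]
    ring
  have hA' : |I₂ + I₄| ≤ C * r ^ 2 := by
    have := abs_add_le_of_opposite_steps (D := 2 * K + 2) hθ1 hs' (hwK k) i₂ i₄ (by
      rw [abs_le] at f₂ f₃ hrw hsw ⊢
      constructor <;> linarith)
    refine this.trans_eq ?_
    rw [hC]
    ring
  have hCr : C * r ^ 2 < C * κ := by
    gcongr
    rw [hrr]
    exact ht.trans_le hκκ
  have hend : p + (0, t • fun i => B i j k) = p₄ + (0, (I₁ + I₃) • u) + (0, (I₂ + I₄) • v) := by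
    refine Prod.ext ?_ ?_
    · simp only [Prod.fst_add, hp₄, hp₃, hp₂, hp₁, stepEnd, Pi.single_neg]
      abel
    · funext i
      have hkj := apply_eq_neg_of_skew (hskew i) k j
      simp only [Prod.snd_add, hp₄, hp₃, hp₂, hp₁, stepEnd, Pi.add_apply, Pi.smul_apply,
        smul_eq_mul, mulVec_add_single_apply, diag_eq_zero_of_skew (hskew i), hkj, hu, hv, ← hts']
      ring
  have hsq : ∀ A, |A| ≤ C * r ^ 2 → ε / (4 * √C) * √|A| ≤ ε / 4 * r := by
    intro A hA
    have : √|A| ≤ √C * r := by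
      rw [← Real.sqrt_sq hr0, ← Real.sqrt_mul hC0.le]
      exact Real.sqrt_le_sqrt hA
    calc ε / (4 * √C) * √|A| ≤ ε / (4 * √C) * (√C * r) := by gcongr
      _ = ε / 4 * r := by field_simp
  have g1 := (h1 p₄ z₄ (by linarith) (I₁ + I₃) (by linarith)).trans (hsq _ hA)
  have g2 := (h2 (p₄ + (0, (I₁ + I₃) • u)) (by simpa using z₄) (by
    refine (norm_add_vert_sub_le _ _ _ _).trans_lt ?_
    have : |I₁ + I₃| * ‖u‖ ≤ C * κ * ‖u‖ := by
      gcongr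
      exact hA.trans hCr.le
    linarith) (I₂ + I₄) (by linarith)).trans (hsq _ hA')
  rw [hend]
  have hθr' : θ * r ≤ ε / 8 * r := by gcongr
  rw [abs_le] at f₁ f₂ f₃ f₄ g1 g2 ⊢
  constructor <;> linarith

/-- `φ` is little `1/2`-Hölder in all vertical directions. -/
theorem HasSteps.vertLittleHolder {m h : ℕ} [NeZero m]
    {B : Fin h → Matrix (Fin m) (Fin m) ℝ} (hskew : ∀ i, (B i).transpose = - B i)
    (hBli : LinearIndependent ℝ B) {φ : G m h → ℝ} {a₀ : G m h} {w : Fin m → ℝ} {M : ℝ}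
    (hM : 0 < M) (H : HasSteps B φ a₀ w M) (v : Fin h → ℝ) : VertLittleHolder φ a₀ v := by
  have hmem : ∀ j k, (fun i => B i j k) ∈ vertLittleHolderSubmodule φ a₀ := by
    intro j k
    by_cases hj : j = 0
    · by_cases hk : k = 0
      · subst hj hk
        have : (fun i => B i 0 0) = 0 := funext fun i => diag_eq_zero_of_skew (hskew i) 0
        rw [this]
        exact zero_mem _
      · subst hj
        have : (fun i => B i 0 k) = -fun i => B i k 0 :=
          funext fun i => apply_eq_neg_of_skew (hskew i) 0 k
        rw [this]
        exact neg_mem (H.vertLittleHolder_col_zero hk)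
    · by_cases hk : k = 0
      · subst hk
        exact H.vertLittleHolder_col_zero hj
      · exact H.vertLittleHolder_of_commutator hskew hM hj hk
  have htop : vertLittleHolderSubmodule φ a₀ = ⊤ := by
    by_contra hne
    obtain ⟨f, hf0, hf⟩ := Submodule.exists_le_ker_of_lt_top _ (lt_top_iff_ne_top.2 hne)
    have hz : ∀ i, f (Pi.single i 1) = 0 := by
      refine Fintype.linearIndependent_iff.1 hBli (fun i => f (Pi.single i 1)) ?_
      ext j k
      have h1 : f (fun i => B i j k) = 0 := hf (hmem j k)
      rw [LinearMap.pi_apply_eq_sum_univ] at h1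
      have hsingle : ∀ i : Fin h, (fun l : Fin h => if i = l then (1 : ℝ) else 0)
          = Pi.single i 1 := by
        intro i
        ext l
        simp [Pi.single_apply, eq_comm]
      simp only [hsingle] at h1
      rw [Matrix.sum_apply, Matrix.zero_apply, ← h1]
      exact Finset.sum_congr rfl fun i _ => by simp [mul_comm]
    exact hf0 (LinearMap.pi_ext' fun i => LinearMap.ext_ring (by simpa using hz i))
  exact (htop ▸ Submodule.mem_top : v ∈ vertLittleHolderSubmodule φ a₀)

theorem exists_abs_sub_le_sqrt_of_vertLittleHolder {m h : ℕ} [NeZero m] {φ : G m h → ℝ}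
    {a₀ : G m h} (H : ∀ v, VertLittleHolder φ a₀ v) {ε : ℝ} (hε : 0 < ε) :
    ∃ ρ > (0 : ℝ), ∀ p q : G m h, p.1 0 = 0 → p.1 = q.1 → ‖p - a₀‖ < ρ → ‖q.2 - p.2‖ < ρ →
      |φ q - φ p| ≤ ε * √‖q.2 - p.2‖ := by
  have key : ∀ s : Finset (Fin h), ∀ ε > (0 : ℝ), ∃ ρ > (0 : ℝ), ∀ p : G m h, p.1 0 = 0 →
      ‖p - a₀‖ < ρ → ∀ t : Fin h → ℝ, ‖t‖ < ρ →
      |φ (p + (0, ∑ i ∈ s, t i • Pi.single i 1)) - φ p| ≤ ε * √‖t‖ := by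
    intro s
    induction s using Finset.induction_on with
    | empty =>
      intro ε hε
      refine ⟨1, one_pos, fun p _ _ t _ => ?_⟩
      rw [Finset.sum_empty, show ((0, 0) : G m h) = 0 from rfl, add_zero, sub_self, abs_zero]
      positivity
    | insert i s his ih =>
      intro ε hε
      obtain ⟨ρ₁, hρ₁, h1⟩ := ih (ε / 2) (by positivity)
      obtain ⟨ρ₂, hρ₂, h2⟩ := H (Pi.single i 1) (ε / 2) (by positivity)
      refine ⟨min (ρ₁ / 2) ρ₂, by positivity, fun p hp0 hp t ht => ?_⟩
      have hp1 := hp.trans_le (min_le_left _ _)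
      have hp2 := hp.trans_le (min_le_right _ _)
      have ht1 := ht.trans_le (min_le_left _ _)
      have ht2 := ht.trans_le (min_le_right _ _)
      have hti : |t i| ≤ ‖t‖ := norm_le_pi_norm t i
      have e2 := h2 p hp0 hp2 (t i) (by linarith)
      have e1 := h1 (p + (0, t i • Pi.single i 1)) (by simpa using hp0) (by
        refine (norm_add_vert_sub_le _ _ _ _).trans_lt ?_
        rw [Pi.norm_single, norm_one, mul_one]
        linarith) t (by linarith)
      have e3 : p + (0, ∑ l ∈ insert i s, t l • Pi.single l (1 : ℝ))
          = p + (0, t i • Pi.single i 1) + (0, ∑ l ∈ s, t l • Pi.single l 1) := by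
        rw [Finset.sum_insert his]
        exact Prod.ext (by simp) (by simp [add_assoc])
      rw [e3]
      have e4 : ε / 2 * √|t i| ≤ ε / 2 * √‖t‖ := by gcongr
      rw [abs_le] at e1 e2 ⊢
      constructor <;> linarith
  obtain ⟨ρ, hρ, h1⟩ := key Finset.univ ε hε
  refine ⟨ρ, hρ, fun p q hp0 hpq hp hq => ?_⟩
  have := h1 p hp0 hp (q.2 - p.2) hq
  have hsum : ∑ i, (q.2 - p.2) i • (Pi.single i (1 : ℝ) : Fin h → ℝ) = q.2 - p.2 := by
    ext l
    simp [Finset.sum_apply, Pi.single_apply]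
  rw [hsum] at this
  have e : p + (0, q.2 - p.2) = q := Prod.ext (by simp [hpq]) (by simp)
  rwa [e] at this

theorem abs_mulVec_apply_le {m : ℕ} (A : Matrix (Fin m) (Fin m) ℝ) (v : Fin m → ℝ) (j : Fin m) :
    |A.mulVec v j| ≤ (∑ k, |A j k|) * ‖v‖ := by
  rw [Matrix.mulVec, dotProduct, Finset.sum_mul]
  refine (Finset.abs_sum_le_sum_abs _ _).trans (Finset.sum_le_sum fun k _ => ?_)
  rw [abs_mul]
  gcongr
  exact norm_le_pi_norm v k

/-- Concatenating the horizontal steps in the directions of a finite set. -/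
theorem HasSteps.exists_path {m h : ℕ} [NeZero m]
    {B : Fin h → Matrix (Fin m) (Fin m) ℝ} {φ : G m h → ℝ} {a₀ : G m h} {w : Fin m → ℝ} {M : ℝ}
    (hM : 0 < M) (H : HasSteps B φ a₀ w M) (s : Finset (Fin m)) (hs : 0 ∉ s) :
    ∃ C ≥ (0 : ℝ), ∀ θ > (0 : ℝ), θ ≤ 1 → ∃ ρ > (0 : ℝ), ∀ a : G m h, a.1 0 = 0 → ‖a - a₀‖ < ρ →
      ∀ Δ : Fin m → ℝ, ‖Δ‖ < ρ → ∃ q : G m h, q.1 = a.1 + ∑ j ∈ s, Pi.single j (Δ j) ∧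
        ‖q - a‖ ≤ C * ‖Δ‖ ∧ |φ q - φ a| ≤ C * ‖Δ‖ ∧
        |φ q - φ a - ∑ j ∈ s, w j * Δ j| ≤ θ * (C * ‖Δ‖) ∧
        ∀ i, |q.2 i - a.2 i + ∑ j ∈ s, Δ j * ((B i).mulVec a.1 j / 2 + B i j 0 * φ a)|
          ≤ C * ‖Δ‖ ^ 2 := by
  induction s using Finset.induction_on with
  | empty =>
    exact ⟨0, le_rfl, fun θ _ _ => ⟨1, one_pos, fun a _ _ Δ _ => ⟨a, by simp⟩⟩⟩
  | insert j s hjs ih =>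
    rw [Finset.mem_insert, not_or] at hs
    obtain ⟨C, hC, ih⟩ := ih hs.2
    have hj : j ≠ 0 := Ne.symm hs.1
    set b : ℝ := ∑ i, ∑ k, |B i j k| with hb
    have hb0 : 0 ≤ b := by positivity
    have hbi : ∀ i, ∑ k, |B i j k| ≤ b := fun i =>
      Finset.single_le_sum (f := fun i => ∑ k, |B i j k|)
        (fun _ _ => Finset.sum_nonneg fun _ _ => abs_nonneg _) (Finset.mem_univ i)
    have hbi0 : ∀ i, |B i j 0| ≤ b := fun i =>
      (Finset.single_le_sum (f := fun k => |B i j k|) (fun _ _ => abs_nonneg _)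
        (Finset.mem_univ 0)).trans (hbi i)
    set K : ℝ := |w j| with hK
    have hK0 : 0 ≤ K := abs_nonneg _
    set C' : ℝ := C + M + K + 1 + b * (2 * C + K + 1) with hC'
    have hbC : 0 ≤ b * (2 * C + K + 1) := by positivity
    refine ⟨C', by positivity, fun θ hθ hθ1 => ?_⟩
    obtain ⟨ρ₁, hρ₁, h1⟩ := ih θ hθ hθ1
    obtain ⟨ρ₂, hρ₂, h2⟩ := H θ hθ
    refine ⟨min ρ₁ (ρ₂ / (1 + C)), by positivity, fun a ha0 ha Δ hΔ => ?_⟩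
    have hle : ρ₂ / (1 + C) ≤ ρ₂ := div_le_self hρ₂.le (by linarith)
    have ha2 := ha.trans_le (min_le_right _ _)
    have hΔ2 := hΔ.trans_le (min_le_right _ _)
    obtain ⟨q, q1, q2, q3, q4, q5⟩ := h1 a ha0 (ha.trans_le (min_le_left _ _)) Δ
      (hΔ.trans_le (min_le_left _ _))
    set N : ℝ := ‖Δ‖ with hN
    have hN0 : 0 ≤ N := norm_nonneg _
    have hΔj : |Δ j| ≤ N := norm_le_pi_norm Δ j
    have hq0 : q.1 0 = 0 := by
      rw [q1, Pi.add_apply, ha0, zero_add, Finset.sum_apply]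
      refine Finset.sum_eq_zero fun l hl => ?_
      exact Pi.single_eq_of_ne (ne_of_mem_of_not_mem hl hs.2).symm _
    have hqa : ‖q - a₀‖ < ρ₂ := by
      rw [← sub_add_sub_cancel q a a₀]
      refine (norm_add_le _ _).trans_lt ?_
      calc ‖q - a‖ + ‖a - a₀‖ < C * (ρ₂ / (1 + C)) + ρ₂ / (1 + C) :=
            add_lt_add_of_le_of_lt (q2.trans (by gcongr)) ha2
        _ = ρ₂ := by field_simp; ring
    obtain ⟨I, -, hI⟩ := h2 j hj q hq0 hqa
    obtain ⟨e1, e2, e3⟩ := hI (Δ j) (by rw [Set.mem_Icc, ← abs_le]; linarith)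
    set c : ℝ := I (Δ j) with hc
    have hMΔ : M * |Δ j| ≤ M * N := by gcongr
    have hKΔ : |w j * Δ j| ≤ K * N := by rw [abs_mul]; gcongr
    have hθΔ : θ * |Δ j| ≤ θ * N := by gcongr
    have hθN : θ * N ≤ N := mul_le_of_le_one_left hN0 hθ1
    have hbCN : 0 ≤ b * (2 * C + K + 1) * N := by positivity
    have hCN : C' * N = C * N + M * N + K * N + N + b * (2 * C + K + 1) * N := by rw [hC']; ring
    have hMN : 0 ≤ M * N := by positivity
    have hKN : 0 ≤ K * N := by positivity
    refine ⟨stepEnd B j q (Δ j) c, ?_, ?_, ?_, ?_, fun i => ?_⟩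
    · simp only [Finset.sum_insert hjs, stepEnd, q1]
      abel
    · rw [← sub_add_sub_cancel _ q a]
      refine (norm_add_le _ _).trans ?_
      linarith
    · rw [abs_le] at q3 e3 hKΔ ⊢
      constructor <;> linarith
    · have hrest : 0 ≤ θ * (M * N + K * N + b * (2 * C + K + 1) * N) := by positivity
      have : θ * (C' * N)
          = θ * (C * N) + θ * N + θ * (M * N + K * N + b * (2 * C + K + 1) * N) := by
        rw [hCN]; ring
      rw [Finset.sum_insert hjs, this]
      rw [abs_le] at q4 e3 ⊢
      constructor <;> linarith
    · have hΔsq : Δ j ^ 2 ≤ N ^ 2 := by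
        rw [← sq_abs]
        gcongr
      have hmv : |(B i).mulVec (q.1 - a.1) j| ≤ b * (C * N) := by
        refine (abs_mulVec_apply_le _ _ _).trans ?_
        gcongr
        · exact hbi i
        · exact (norm_fst_le (q - a)).trans q2
      have hd : |c - φ a * Δ j| ≤ (C + K + 1) * N ^ 2 := by
        have g1 : |(φ q - φ a) * Δ j| ≤ C * N ^ 2 := by
          rw [abs_mul, pow_two, ← mul_assoc]
          gcongr
        have g2 : |w j * Δ j ^ 2| ≤ K * N ^ 2 := by
          rw [abs_mul, abs_of_nonneg (sq_nonneg (Δ j))]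
          gcongr
        have g3 : θ * Δ j ^ 2 ≤ N ^ 2 := (mul_le_of_le_one_left (sq_nonneg _) hθ1).trans hΔsq
        have g4 : 0 ≤ K * N ^ 2 := by positivity
        rw [abs_le] at g1 g2 e2 ⊢
        constructor <;> linarith
      have hterm1 : |Δ j / 2 * (B i).mulVec (q.1 - a.1) j| ≤ b * C * N ^ 2 := by
        rw [abs_mul, abs_div, abs_two]
        have : |Δ j| / 2 ≤ N := by linarith [abs_nonneg (Δ j)]
        calc |Δ j| / 2 * |(B i).mulVec (q.1 - a.1) j| ≤ N * (b * (C * N)) := by gcongr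
          _ = b * C * N ^ 2 := by ring
      have hterm2 : |B i j 0 * (c - φ a * Δ j)| ≤ b * (C + K + 1) * N ^ 2 := by
        rw [abs_mul, mul_assoc]
        gcongr
        exact hbi0 i
      have hsplit : (stepEnd B j q (Δ j) c).2 i - a.2 i
            + ∑ l ∈ insert j s, Δ l * ((B i).mulVec a.1 l / 2 + B i l 0 * φ a)
          = (q.2 i - a.2 i + ∑ l ∈ s, Δ l * ((B i).mulVec a.1 l / 2 + B i l 0 * φ a))
            - Δ j / 2 * (B i).mulVec (q.1 - a.1) j - B i j 0 * (c - φ a * Δ j) := by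
        rw [Finset.sum_insert hjs, Matrix.mulVec_sub]
        simp only [stepEnd, Pi.sub_apply]
        ring
      have hq5 := q5 i
      rw [hsplit]
      have hCN2 : C' * N ^ 2 = C * N ^ 2 + b * C * N ^ 2 + b * (C + K + 1) * N ^ 2
          + (M + K + 1) * N ^ 2 := by rw [hC']; ring
      have hrest : 0 ≤ (M + K + 1) * N ^ 2 := by positivity
      rw [abs_le] at hq5 hterm1 hterm2 ⊢
      constructor <;> linarith

theorem gmul_snd {m h : ℕ} (B : Fin h → Matrix (Fin m) (Fin m) ℝ) (p q : G m h) (i : Fin h) :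
    (gmul B p q).2 i = p.2 i + q.2 i - 1 / 2 * (q.1 ⬝ᵥ (B i).mulVec p.1) := by
  simp only [gmul, dotProduct, Matrix.mulVec, Finset.mul_sum]
  congr 1
  exact Finset.sum_congr rfl fun j _ => Finset.sum_congr rfl fun k _ => by ring

theorem dotProduct_mulVec_skew {m : ℕ} {A : Matrix (Fin m) (Fin m) ℝ} (hA : A.transpose = -A)
    (u v : Fin m → ℝ) : u ⬝ᵥ A.mulVec v = -(v ⬝ᵥ A.mulVec u) := by
  rw [Matrix.dotProduct_mulVec, ← Matrix.mulVec_transpose, hA, Matrix.neg_mulVec, neg_dotProduct,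
    dotProduct_comm]

theorem shiftQ_fst {m h : ℕ} [NeZero m] (B : Fin h → Matrix (Fin m) (Fin m) ℝ) (φ : G m h → ℝ)
    (a b : G m h) : (shiftQ B φ a b).1 = b.1 - a.1 := by
  simp only [shiftQ, gmul, ginv]
  abel

theorem shiftQ_snd {m h : ℕ} [NeZero m] {B : Fin h → Matrix (Fin m) (Fin m) ℝ}
    (hskew : ∀ i, (B i).transpose = - B i) (φ : G m h → ℝ) (a b : G m h) (i : Fin h) :
    (shiftQ B φ a b).2 i = b.2 i - a.2 i
      + ∑ j, (b.1 j - a.1 j) * ((B i).mulVec a.1 j / 2 + B i j 0 * φ a) := by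
  have hPhi : (Phi φ a).1 = Pi.single 0 (φ a) := by
    funext j
    simp [Phi, Pi.single_apply]
  have hmv : ∀ j, (B i).mulVec (Phi φ a).1 j = B i j 0 * φ a := fun j => by
    simp [hPhi, Matrix.mulVec_single, mul_comm]
  have hsum : ∑ j, (b.1 j - a.1 j) * ((B i).mulVec a.1 j / 2 + B i j 0 * φ a)
      = 1 / 2 * ((b.1 - a.1) ⬝ᵥ (B i).mulVec a.1) + (b.1 - a.1) ⬝ᵥ (B i).mulVec (Phi φ a).1 := by
    simp only [dotProduct, hmv, Finset.mul_sum, ← Finset.sum_add_distrib]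
    exact Finset.sum_congr rfl fun j _ => by simp only [Pi.sub_apply]; ring
  have haa := dotProduct_mulVec_skew (hskew i) a.1 a.1
  have hPP := dotProduct_mulVec_skew (hskew i) (Phi φ a).1 (Phi φ a).1
  have haP := dotProduct_mulVec_skew (hskew i) (Phi φ a).1 a.1
  have hbP := dotProduct_mulVec_skew (hskew i) (Phi φ a).1 b.1
  have h2 : (Phi φ a).2 i = 0 := rfl
  rw [hsum]
  simp only [shiftQ, gmul_snd]
  simp only [gmul, ginv, Pi.neg_apply, h2, Matrix.mulVec_add, Matrix.mulVec_neg, dotProduct_add,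
    dotProduct_neg, neg_dotProduct, sub_dotProduct]
  linarith

theorem abs_fst_le_hnorm {m h : ℕ} (p : G m h) (j : Fin m) : |p.1 j| ≤ hnorm p := by
  have h1 := Finset.single_le_sum (f := fun j => |p.1 j|) (fun _ _ => abs_nonneg _)
    (Finset.mem_univ j)
  have h2 : 0 ≤ ∑ i, √|p.2 i| := by positivity
  unfold hnorm
  linarith

theorem abs_snd_le_hnorm_sq {m h : ℕ} (p : G m h) (i : Fin h) : |p.2 i| ≤ hnorm p ^ 2 := by
  have h1 := Finset.single_le_sum (f := fun i => √|p.2 i|) (fun _ _ => Real.sqrt_nonneg _)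
    (Finset.mem_univ i)
  have h2 : 0 ≤ ∑ j, |p.1 j| := by positivity
  rw [← Real.sqrt_le_left (by unfold hnorm; positivity)]
  unfold hnorm
  linarith

theorem hnorm_nonneg {m h : ℕ} (p : G m h) : 0 ≤ hnorm p := by
  unfold hnorm
  positivity

theorem exists_norm_sub_lt_of_gdist_lt {m h : ℕ} {B : Fin h → Matrix (Fin m) (Fin m) ℝ}
    (hskew : ∀ i, (B i).transpose = - B i) (a₀ : G m h) {ρ : ℝ} (hρ : 0 < ρ) :
    ∃ r > (0 : ℝ), ∀ a, gdist B a₀ a < r → ‖a - a₀‖ < ρ := by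
  have hmul : ∀ a, gmul B a₀ (gmul B (ginv a₀) a) = a := by
    intro a
    refine Prod.ext ?_ (funext fun i => ?_)
    · simp [gmul, ginv]
    · have := dotProduct_mulVec_skew (hskew i) a₀.1 a₀.1
      simp only [gmul_snd]
      simp only [gmul, ginv, Pi.neg_apply, Matrix.mulVec_neg, add_dotProduct, dotProduct_neg,
        neg_dotProduct]
      linarith
  have hcont : Continuous (fun p => gmul B a₀ p) := by
    unfold gmul
    fun_prop
  have h0 : gmul B a₀ 0 = a₀ := by simp [gmul]
  obtain ⟨δ, hδ, hball⟩ := Metric.continuous_iff.1 hcont 0 ρ hρ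
  rw [h0] at hball
  refine ⟨min (δ / 2) 1, by positivity, fun a ha => ?_⟩
  set g := gmul B (ginv a₀) a with hg
  have ha' : hnorm g < min (δ / 2) 1 := ha
  have hδ2 := ha'.trans_le (min_le_left _ _)
  have h1 := ha'.trans_le (min_le_right _ _)
  have hn0 := hnorm_nonneg g
  have hnorm_g : ‖g‖ ≤ δ / 2 := by
    rw [Prod.norm_def, max_le_iff, pi_norm_le_iff_of_nonneg (by positivity),
      pi_norm_le_iff_of_nonneg (by positivity)]
    constructor
    · intro j
      exact (abs_fst_le_hnorm g j).trans hδ2.le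
    · intro i
      exact (abs_snd_le_hnorm_sq g i).trans ((pow_le_of_le_one hn0 h1.le two_ne_zero).trans hδ2.le)
  have := hball g (by rw [dist_zero_right]; linarith)
  rwa [hmul, dist_eq_norm] at this

theorem HasSteps.uidAt {m h : ℕ} [NeZero m]
    {B : Fin h → Matrix (Fin m) (Fin m) ℝ} (hskew : ∀ i, (B i).transpose = - B i)
    (hBli : LinearIndependent ℝ B) {U : Set (G m h)} (hUW : U ⊆ Wset m h) {φ : G m h → ℝ}
    {a₀ : G m h} {w : Fin m → ℝ} {M : ℝ} (hM : 0 < M) (H : HasSteps B φ a₀ w M) :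
    UIDAt B U φ a₀ w := by
  intro ε hε
  obtain ⟨C, hC, hpath⟩ := H.exists_path hM (Finset.univ.erase 0) (by simp)
  obtain ⟨ρ₁, hρ₁, hpath⟩ := hpath (min 1 (ε / (2 * (1 + C)))) (by positivity) (min_le_left _ _)
  obtain ⟨ρ₂, hρ₂, hvert⟩ := exists_abs_sub_le_sqrt_of_vertLittleHolder
    (H.vertLittleHolder hskew hBli hM) (ε := ε / (2 * √(1 + C))) (by positivity)
  set ρ : ℝ := min (ρ₁ / 2) (ρ₂ / (2 * (1 + C))) with hρdef
  have hρ : 0 < ρ := by positivity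
  have hρ1 : 2 * ρ ≤ ρ₁ := by
    have : ρ ≤ ρ₁ / 2 := min_le_left _ _
    linarith
  have hρ2 : ρ + C * (2 * ρ) + ρ ≤ ρ₂ := by
    have : ρ ≤ ρ₂ / (2 * (1 + C)) := min_le_right _ _
    rw [le_div_iff₀ (by positivity)] at this
    linarith
  obtain ⟨r, hr, hball⟩ := exists_norm_sub_lt_of_gdist_lt hskew a₀ hρ
  refine ⟨r, hr, fun a ha b hb har hbr _ => ?_⟩
  have ha0 : a.1 0 = 0 := hUW ha
  have hb0 : b.1 0 = 0 := hUW hb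
  have haρ := hball a har
  have hbρ := hball b hbr
  have hba : ‖b - a‖ < 2 * ρ := by
    rw [← sub_sub_sub_cancel_right b a a₀]
    linarith [norm_sub_le (b - a₀) (a - a₀)]
  have hΔle : ‖b.1 - a.1‖ ≤ ‖b - a‖ := norm_fst_le (b - a)
  obtain ⟨q, q1, q2, -, q4, q5⟩ := hpath a ha0 (by linarith) (b.1 - a.1) (by linarith)
  set N := hnorm (shiftQ B φ a b) with hN
  have hN0 : 0 ≤ N := hnorm_nonneg _
  have hΔN : ‖b.1 - a.1‖ ≤ N := by
    rw [pi_norm_le_iff_of_nonneg hN0]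
    intro j
    rw [← shiftQ_fst B φ a b]
    exact abs_fst_le_hnorm _ j
  have hqb : q.1 = b.1 := by
    have h1 : ∑ j, Pi.single j ((b.1 - a.1) j) = b.1 - a.1 := Finset.univ_sum_single _
    rw [← Finset.add_sum_erase _ _ (Finset.mem_univ 0)] at h1
    simp only [Pi.sub_apply, ha0, hb0, sub_self, Pi.single_zero, zero_add] at h1
    rw [q1]
    simp only [Pi.sub_apply]
    rw [h1]
    abel
  have hsnd : ‖b.2 - q.2‖ ≤ (1 + C) * N ^ 2 := by
    rw [pi_norm_le_iff_of_nonneg (by positivity)]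
    intro i
    have h1 := abs_snd_le_hnorm_sq (shiftQ B φ a b) i
    have h2 := q5 i
    have h3 : C * ‖b.1 - a.1‖ ^ 2 ≤ C * N ^ 2 := by gcongr
    rw [shiftQ_snd hskew, ← Finset.add_sum_erase _ _ (Finset.mem_univ 0), ha0, hb0, sub_self,
      zero_mul, zero_add] at h1
    simp only [Pi.sub_apply] at h2
    rw [Real.norm_eq_abs, Pi.sub_apply]
    rw [abs_le] at h1 h2 ⊢
    constructor <;> linarith
  have hqa : ‖q - a₀‖ < ρ + C * (2 * ρ) := by
    rw [← sub_add_sub_cancel q a a₀]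
    have : C * ‖b.1 - a.1‖ ≤ C * (2 * ρ) := by
      gcongr
      linarith
    linarith [norm_add_le (q - a) (a - a₀)]
  have hv := hvert q b (by rw [hqb, hb0]) hqb (by linarith) (by
    refine (norm_snd_le (b - q)).trans_lt ?_
    rw [← sub_sub_sub_cancel_right b q a₀]
    linarith [norm_sub_le (b - a₀) (q - a₀)])
  have hv' : |φ b - φ q| ≤ ε / 2 * N := by
    refine hv.trans ?_
    have : √‖b.2 - q.2‖ ≤ √(1 + C) * N := by
      rw [← Real.sqrt_sq hN0, ← Real.sqrt_mul (by positivity)]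
      exact Real.sqrt_le_sqrt hsnd
    calc ε / (2 * √(1 + C)) * √‖b.2 - q.2‖ ≤ ε / (2 * √(1 + C)) * (√(1 + C) * N) := by gcongr
      _ = ε / 2 * N := by field_simp
  have hh : min 1 (ε / (2 * (1 + C))) * (C * ‖b.1 - a.1‖) ≤ ε / 2 * N := by
    calc min 1 (ε / (2 * (1 + C))) * (C * ‖b.1 - a.1‖)
        ≤ ε / (2 * (1 + C)) * ((1 + C) * N) := by
          gcongr
          · exact min_le_right _ _
          · linarith
      _ = ε / 2 * N := by field_simp
  have q4' := q4.trans hh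
  simp only [Pi.sub_apply] at q4'
  rw [abs_le] at hv' q4' ⊢
  constructor <;> linarith

/-- In a step-2 Carnot group, if `D^φφ = ω` in the broad* sense on `U` for
some continuous `ω`, then `φ ∈ UID(U)` and `∇^φφ = ω` on `U`. -/
theorem statement18 (m h : ℕ) [NeZero m] (hm : 2 ≤ m) (hh : 1 ≤ h)
    (B : Fin h → Matrix (Fin m) (Fin m) ℝ)
    (hskew : ∀ i, (B i).transpose = - B i) (hBli : LinearIndependent ℝ B)
    (U : Set (G m h)) (hUW : U ⊆ Wset m h) (hUopen : RelOpen m h U)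
    (φ : G m h → ℝ) (hφ : ContinuousOn φ U)
    (ω : G m h → Fin m → ℝ)
    (hω : ∀ j : Fin m, j ≠ 0 → ContinuousOn (fun w => ω w j) U)
    (hbroad : IsBroadStar B U φ ω) :
    ∀ a₀ ∈ U, UIDAt B U φ a₀ (ω a₀) := by
  intro a₀ ha₀
  obtain ⟨M, hM, H⟩ := hasSteps_of_isBroadStar hskew hUopen hφ hω hbroad ha₀
  exact H.uidAt hskew hBli hUW hM

end Step2
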